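/- (Corollary 3.1, comparison form.) Fix integers n ≥ 2, m ≥ 1, N ≥ 1 and p ∈ (1,∞). Let α = (γ_1,…,γ_(N+1), l) ∈ {1,…,n+m}^(N+2) be a word of length N+2 such that either l ≤ n, or l > n and at least one of γ_1,…,γ_(N+1) is greater than n. Then there exists a constant c > 0 such that for every φ ∈ C_c^∞(ℝ^(n+m)) one has ‖Y^α φ‖_p ≤ c · max_{β} ‖X^β φ‖_p, where the maximum is over all words β of elements of 𝒳 with |β| = N+2. -/

import Mathlib

open MeasureTheory
open scoped ENNReal NNReal

/-- Points of `ℝ^(n+m)`, written `(x, y)` with `x ∈ ℝⁿ`, `y ∈ ℝᵐ`. -/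
abbrev Pt (n m : ℕ) := (Fin n → ℝ) × (Fin m → ℝ)

/-- The partial derivative operator `∂_{x_j}`. -/
noncomputable def Dx (n m : ℕ) (j : Fin n) (f : Pt n m → ℝ) : Pt n m → ℝ :=
  fun z => fderiv ℝ f z (Pi.single j 1, 0)

/-- The partial derivative operator `∂_{y_k}`. -/
noncomputable def Dy (n m : ℕ) (k : Fin m) (f : Pt n m → ℝ) : Pt n m → ℝ :=
  fun z => fderiv ℝ f z (0, Pi.single k 1)

/-- Index set for the family `𝒳`: either `j ∈ {1,…,n}` (giving `X_j = ∂_{x_j}`) or a pair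
of a multi-index `ν ∈ ℕⁿ` with `|ν| = N` and `k ∈ {1,…,m}` (giving
`X_{ν,k} = (N!/ν!)^(1/2) x^ν ∂_{y_k}`). -/
def XIdx (n m N : ℕ) := Fin n ⊕ ({ν : Fin n → ℕ // ∑ i, ν i = N} × Fin m)

/-- The family `𝒳` of first-order operators `X_j = ∂_{x_j}` and
`X_{ν,k} = (N!/ν!)^(1/2) x^ν ∂_{y_k}` for `|ν| = N`. -/
noncomputable def Xop (n m N : ℕ) : XIdx n m N → (Pt n m → ℝ) → (Pt n m → ℝ)
  | Sum.inl j => Dx n m j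
  | Sum.inr (ν, k) => fun f z =>
      Real.sqrt ((Nat.factorial N : ℝ) / ∏ i, (Nat.factorial (ν.1 i) : ℝ)) *
        (∏ i, z.1 i ^ ν.1 i) * Dy n m k f z

/-- Composition `Z_1 ∘ Z_2 ∘ ⋯ ∘ Z_s` of a word of operators. -/
def compOps {n m : ℕ} (l : List ((Pt n m → ℝ) → (Pt n m → ℝ))) :
    (Pt n m → ℝ) → (Pt n m → ℝ) :=
  l.foldr (· ∘ ·) id

/-- `X^α` for a word `α` of elements of `𝒳`. -/
noncomputable def Xw {n m N M : ℕ} (α : Fin M → XIdx n m N) :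
    (Pt n m → ℝ) → (Pt n m → ℝ) :=
  compOps (List.ofFn fun i => Xop n m N (α i))

/-- The Gru\v{s}in operator `H_N = −Δ_x − |x|^(2N) Δ_y`. -/
noncomputable def grusin (n m N : ℕ) (f : Pt n m → ℝ) : Pt n m → ℝ :=
  fun z => -(∑ j, Dx n m j (Dx n m j f) z) -
    (∑ i, z.1 i ^ 2) ^ N * ∑ k, Dy n m k (Dy n m k f) z

/-- The operators `Y_j = ∂_{x_j}` for `j ≤ n` and `Y_{n+l} = |x|^N ∂_{y_l}` for `l ≤ m`. -/
noncomputable def Yop (n m N : ℕ) : (Fin n ⊕ Fin m) → (Pt n m → ℝ) → (Pt n m → ℝ)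
  | Sum.inl j => Dx n m j
  | Sum.inr l => fun f z => Real.sqrt (∑ i, z.1 i ^ 2) ^ N * Dy n m l f z

/-- `Y^α` for a word `α ∈ {1,…,n+m}^M`. -/
noncomputable def Yw {n m N M : ℕ} (α : Fin M → (Fin n ⊕ Fin m)) :
    (Pt n m → ℝ) → (Pt n m → ℝ) :=
  compOps (List.ofFn fun i => Yop n m N (α i))

/-- The space of smooth real functions on `ℝ^(n+m)`. -/
def smoothFns (n m : ℕ) : Submodule ℝ (Pt n m → ℝ) where
  carrier := {f | ContDiff ℝ (⊤ : ℕ∞) f}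
  add_mem' hf hg := by
    rw [Set.mem_ofPred_eq] at *
    exact hf.add hg
  zero_mem' := by
    rw [Set.mem_ofPred_eq]
    exact contDiff_const
  smul_mem' c f hf := by
    rw [Set.mem_ofPred_eq] at *
    exact hf.const_smul c

lemma smoothFns_contDiff {n m : ℕ} (f : smoothFns n m) : ContDiff ℝ (⊤ : ℕ∞) f.1 := f.2

lemma smoothFns_differentiableAt {n m : ℕ} (f : smoothFns n m) (z : Pt n m) :
    DifferentiableAt ℝ f.1 z :=
  (smoothFns_contDiff f).differentiable (by simp) z

/-- The directional derivative along `v` as an endomorphism of the smooth functions. -/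
noncomputable def dirDeriv {n m : ℕ} (v : Pt n m) : Module.End ℝ (smoothFns n m) where
  toFun f := ⟨fun z => fderiv ℝ f.1 z v,
    ((smoothFns_contDiff f).fderiv_right (m := (⊤ : ℕ∞)) (by simp)).clm_apply contDiff_const⟩
  map_add' f g := by
    ext z
    simp [fderiv_add (smoothFns_differentiableAt f z) (smoothFns_differentiableAt g z)]
  map_smul' c f := by
    ext z
    simp [fderiv_const_smul (smoothFns_differentiableAt f z) c]

/-- `∂_{x_j}` on smooth functions. -/
noncomputable abbrev dxEnd {n : ℕ} (m : ℕ) (j : Fin n) : Module.End ℝ (smoothFns n m) :=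
  dirDeriv (Pi.single j 1, 0)

/-- `∂_{y_k}` on smooth functions. -/
noncomputable abbrev dyEnd (n : ℕ) {m : ℕ} (k : Fin m) : Module.End ℝ (smoothFns n m) :=
  dirDeriv (0, Pi.single k 1)

/-- Multiplication by the coordinate `x_i` on smooth functions. -/
def mulX {n : ℕ} (m : ℕ) (i : Fin n) : Module.End ℝ (smoothFns n m) where
  toFun f := ⟨fun z => z.1 i * f.1 z,
    ((contDiff_apply ℝ ℝ i).comp contDiff_fst).mul (smoothFns_contDiff f)⟩
  map_add' f g := by
    ext z
    simp [mul_add]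
  map_smul' c f := by
    ext z
    simp [mul_left_comm]

lemma mulX_pow_apply {n m : ℕ} (i : Fin n) (j : ℕ) (f : smoothFns n m) (z : Pt n m) :
    (((mulX m i) ^ j) f).1 z = z.1 i ^ j * f.1 z := by
  induction j with
  | zero => simp
  | succ j ih =>
    rw [pow_succ', Module.End.mul_apply]
    change z.1 i * _ = _
    rw [ih]
    ring

lemma dirDeriv_mul_mulX {n m : ℕ} (v : Pt n m) (i : Fin n) :
    dirDeriv v * mulX m i = mulX m i * dirDeriv v + v.1 i • 1 := by
  ext f z
  have hx : HasFDerivAt (fun z : Pt n m => z.1 i)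
      ((ContinuousLinearMap.proj i).comp (ContinuousLinearMap.fst ℝ _ _)) z :=
    ContinuousLinearMap.hasFDerivAt
      ((ContinuousLinearMap.proj (R := ℝ) i).comp
        (ContinuousLinearMap.fst ℝ (Fin n → ℝ) (Fin m → ℝ)))
  have h := (hx.mul (smoothFns_differentiableAt f z).hasFDerivAt).fderiv
  change fderiv ℝ (fun z : Pt n m => z.1 i * f.1 z) z v =
    z.1 i * fderiv ℝ f.1 z v + v.1 i * f.1 z
  change fderiv ℝ (fun z : Pt n m => z.1 i * f.1 z) z = _ at h
  rw [h]
  simp [mul_comm]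

lemma dirDeriv_commute {n m : ℕ} (v w : Pt n m) : Commute (dirDeriv v) (dirDeriv w) := by
  ext f z
  have hd : DifferentiableAt ℝ (fderiv ℝ f.1) z :=
    ((smoothFns_contDiff f).fderiv_right (m := (⊤ : ℕ∞)) (by simp)).differentiable (by simp) z
  have key (a b : Pt n m) : fderiv ℝ (fun z => fderiv ℝ f.1 z a) z b =
      fderiv ℝ (fderiv ℝ f.1) z b a := by
    rw [fderiv_clm_apply hd (differentiableAt_const a)]
    simp
  have hs : IsSymmSndFDerivAt ℝ f.1 z :=
    (smoothFns_contDiff f).contDiffAt.isSymmSndFDerivAt (by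
      rw [minSmoothness_of_isRCLikeNormedField]
      exact WithTop.coe_le_coe.2 le_top)
  change fderiv ℝ (fun z => fderiv ℝ f.1 z w) z v = fderiv ℝ (fun z => fderiv ℝ f.1 z v) z w
  rw [key, key, hs]

lemma dyEnd_commute_mulX {n m : ℕ} (k : Fin m) (i : Fin n) :
    Commute (dyEnd n k) (mulX m i) := by
  have h := dirDeriv_mul_mulX (n := n) (0, Pi.single k 1) i
  simpa [Commute, SemiconjBy] using h

lemma dxEnd_mul_mulX_pow {n : ℕ} (m : ℕ) (i : Fin n) (j : ℕ) :
    dxEnd m i * mulX m i ^ (j + 1) =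
      mulX m i ^ (j + 1) * dxEnd m i + ((j : ℝ) + 1) • mulX m i ^ j := by
  have h : dxEnd m i * mulX m i = mulX m i * dxEnd m i + 1 := by
    simpa using dirDeriv_mul_mulX (m := m) (Pi.single i 1, 0) i
  induction j with
  | zero => simpa using h
  | succ j ih =>
    rw [pow_succ, ← mul_assoc, ih, add_mul, mul_assoc _ _ (mulX m i), h]
    simp only [pow_succ, mul_add, mul_assoc, mul_one, smul_mul_assoc]
    push_cast
    module

/-- The generators `∂_{x_j}` and `x_i^N ∂_{y_k}`. -/
noncomputable def genEnd (n m N : ℕ) : Fin n ⊕ (Fin n × Fin m) → Module.End ℝ (smoothFns n m)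
  | Sum.inl j => dxEnd m j
  | Sum.inr (i, k) => mulX m i ^ N * dyEnd n k

/-- The position in the family `𝒳` of the generators `∂_{x_j}` and `x_i^N ∂_{y_k}`. -/
def genIdx (n m N : ℕ) : Fin n ⊕ (Fin n × Fin m) → XIdx n m N
  | Sum.inl j => Sum.inl j
  | Sum.inr (i, k) => Sum.inr (⟨Pi.single i N, by simp⟩, k)

lemma Xop_genIdx {n m N : ℕ} (g : Fin n ⊕ (Fin n × Fin m)) (f : smoothFns n m) :
    Xop n m N (genIdx n m N g) f.1 = (genEnd n m N g f).1 := by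
  rcases g with j | ⟨i, k⟩
  · rfl
  · ext z
    have h1 : ∏ l, (Nat.factorial ((Pi.single i N : Fin n → ℕ) l) : ℝ) = Nat.factorial N := by
      rw [Finset.prod_eq_single i] <;> simp +contextual
    have h2 : ∏ l, z.1 l ^ ((Pi.single i N : Fin n → ℕ) l) = z.1 i ^ N := by
      rw [Finset.prod_eq_single i] <;> simp +contextual
    have h3 : (Nat.factorial N : ℝ) ≠ 0 := by positivity
    change Real.sqrt ((Nat.factorial N : ℝ) / ∏ l, (Nat.factorial
        ((Pi.single i N : Fin n → ℕ) l) : ℝ)) *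
      (∏ l, z.1 l ^ ((Pi.single i N : Fin n → ℕ) l)) * Dy n m k f.1 z = _
    rw [h1, h2, div_self h3, Real.sqrt_one, one_mul, genEnd, Module.End.mul_apply,
      mulX_pow_apply]
    rfl

lemma compOps_map_eq_prod {n m : ℕ} {ι : Type*} (op : ι → (Pt n m → ℝ) → Pt n m → ℝ)
    (e : ι → Module.End ℝ (smoothFns n m)) (h : ∀ i (f : smoothFns n m), op i f.1 = (e i f).1)
    (l : List ι) (f : smoothFns n m) :
    compOps (l.map op) f.1 = ((l.map e).prod f).1 := by
  induction l with
  | nil => rfl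
  | cons i l ih =>
    change op i (compOps (l.map op) f.1) = _
    rw [ih, h]
    simp

lemma Xw_genIdx {n m N M : ℕ} (β : Fin M → Fin n ⊕ (Fin n × Fin m)) (f : smoothFns n m) :
    Xw (fun i => genIdx n m N (β i)) f.1 =
      ((List.ofFn fun i => genEnd n m N (β i)).prod f).1 := by
  have h := compOps_map_eq_prod _ _ (Xop_genIdx (n := n) (m := m) (N := N)) (List.ofFn β) f
  rw [List.map_ofFn, List.map_ofFn] at h
  exact h

/-- The span of the operators `∂_{x_j}` and `x_i^N ∂_{y_k}`. -/
noncomputable def genSpan (n m N : ℕ) : Submodule ℝ (Module.End ℝ (smoothFns n m)) :=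
  Submodule.span ℝ (Set.range (genEnd n m N))

lemma exists_bound_of_mem_genSpan_pow {n m N M : ℕ} {B : Module.End ℝ (smoothFns n m)}
    (hB : B ∈ genSpan n m N ^ M) :
    ∃ C : ℝ, 0 ≤ C ∧ ∀ (f : smoothFns n m) (z : Pt n m), |(B f).1 z| ≤
      C * ∑ β : Fin M → Fin n ⊕ (Fin n × Fin m), |Xw (fun i => genIdx n m N (β i)) f.1 z| := by
  rw [genSpan, Submodule.span_pow] at hB
  induction hB using Submodule.span_induction with
  | mem B hB =>
    obtain ⟨b, rfl⟩ := Set.mem_pow.1 hB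
    choose β hβ using fun i => (b i).2
    refine ⟨1, zero_le_one, fun f z => ?_⟩
    simp only [← hβ]
    rw [← Xw_genIdx, one_mul]
    exact Finset.single_le_sum (f := fun β : Fin M → Fin n ⊕ (Fin n × Fin m) =>
      |Xw (fun i => genIdx n m N (β i)) f.1 z|) (fun _ _ => abs_nonneg _) (Finset.mem_univ β)
  | zero => exact ⟨0, le_rfl, fun f z => by simp⟩
  | add B B' _ _ h h' =>
    obtain ⟨C, hC, h⟩ := h
    obtain ⟨C', hC', h'⟩ := h'
    refine ⟨C + C', by positivity, fun f z => ?_⟩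
    rw [add_mul]
    exact (abs_add_le _ _).trans (add_le_add (h f z) (h' f z))
  | smul c B _ h =>
    obtain ⟨C, hC, h⟩ := h
    refine ⟨|c| * C, by positivity, fun f z => ?_⟩
    change |c * (B f).1 z| ≤ _
    rw [abs_mul, mul_assoc]
    exact mul_le_mul_of_nonneg_left (h f z) (abs_nonneg c)

lemma dxEnd_mem_genSpan {n : ℕ} (m N : ℕ) (j : Fin n) : dxEnd m j ∈ genSpan n m N :=
  Submodule.subset_span ⟨Sum.inl j, rfl⟩

lemma mulX_pow_mul_dyEnd_mem {n m N : ℕ} (i : Fin n) (k : Fin m) (d : ℕ) :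
    ∀ j, j + d = N → mulX m i ^ j * dyEnd n k ∈ genSpan n m N ^ (d + 1) := by
  induction d with
  | zero =>
    rintro j rfl
    rw [zero_add, pow_one]
    exact Submodule.subset_span ⟨Sum.inr (i, k), rfl⟩
  | succ d ih =>
    intro j hj
    have h := ih (j + 1) (by omega)
    have hx := dxEnd_mem_genSpan m N i
    have h1 : dxEnd m i * (mulX m i ^ (j + 1) * dyEnd n k) ∈ genSpan n m N ^ (d + 1 + 1) := by
      rw [pow_succ']
      exact Submodule.mul_mem_mul hx h
    have h2 : mulX m i ^ (j + 1) * dyEnd n k * dxEnd m i ∈ genSpan n m N ^ (d + 1 + 1) := by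
      rw [pow_succ]
      exact Submodule.mul_mem_mul h hx
    have hc : dyEnd n k * dxEnd m i = dxEnd m i * dyEnd n k := dirDeriv_commute _ _
    have h3 : ((j : ℝ) + 1) • (mulX m i ^ j * dyEnd n k) =
        dxEnd m i * (mulX m i ^ (j + 1) * dyEnd n k) +
          (-1 : ℝ) • (mulX m i ^ (j + 1) * dyEnd n k * dxEnd m i) := by
      rw [← mul_assoc, dxEnd_mul_mulX_pow, mul_assoc _ (dyEnd n k), hc, add_mul, mul_assoc,
        smul_mul_assoc]
      module
    have h4 := add_mem h1 (Submodule.smul_mem _ (-1 : ℝ) h2)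
    rw [← h3] at h4
    exact (Submodule.smul_mem_iff _ (by positivity)).1 h4

lemma mulX_pow_mul_prod_dyEnd_mem {n m N : ℕ} (i : Fin n) (ks : List (Fin m)) :
    mulX m i ^ (N * ks.length) * (ks.map (dyEnd n)).prod ∈ genSpan n m N ^ ks.length := by
  induction ks with
  | nil =>
    simp only [List.length_nil, mul_zero, pow_zero, List.map_nil, List.prod_nil, mul_one]
    exact Submodule.one_le.1 le_rfl
  | cons k ks ih =>
    have hc : dyEnd n k * mulX m i ^ (N * ks.length) = mulX m i ^ (N * ks.length) * dyEnd n k :=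
      (dyEnd_commute_mulX k i).pow_right _
    have h := mulX_pow_mul_dyEnd_mem (N := N) i k 0 N (by simp)
    rw [zero_add, pow_one] at h
    rw [List.length_cons, pow_succ', List.map_cons, List.prod_cons, Nat.mul_succ, add_comm,
      pow_add]
    convert Submodule.mul_mem_mul h ih using 1
    rw [mul_assoc, mul_assoc, ← mul_assoc (mulX m i ^ (N * ks.length)), ← hc, mul_assoc]

lemma prod_dxEnd_mem {n m N : ℕ} (js : List (Fin n)) :
    (js.map (dxEnd m)).prod ∈ genSpan n m N ^ js.length := by
  induction js with
  | nil => exact Submodule.one_le.1 le_rfl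
  | cons j js ih =>
    rw [List.length_cons, pow_succ', List.map_cons, List.prod_cons]
    exact Submodule.mul_mem_mul (dxEnd_mem_genSpan m N j) ih

lemma mulX_pow_mul_derivs_mem {n m N : ℕ} (i : Fin n) {ks : List (Fin m)} (js : List (Fin n))
    {d e : ℕ} (hks : ks ≠ []) (hd : d ≤ N) (he : e + d = N * ks.length) :
    mulX m i ^ e * ((ks.map (dyEnd n)).prod * (js.map (dxEnd m)).prod) ∈
      genSpan n m N ^ (ks.length + (d + js.length)) := by
  obtain ⟨k, ks, rfl⟩ := List.exists_cons_of_ne_nil hks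
  have hc : dyEnd n k * mulX m i ^ (N * ks.length) = mulX m i ^ (N * ks.length) * dyEnd n k :=
    (dyEnd_commute_mulX k i).pow_right _
  have h1 := mulX_pow_mul_dyEnd_mem (N := N) i k d (N - d) (by omega)
  have h2 := mulX_pow_mul_prod_dyEnd_mem (N := N) i ks
  have h3 := prod_dxEnd_mem (m := m) (N := N) js
  have h := Submodule.mul_mem_mul (Submodule.mul_mem_mul h1 h2) h3
  rw [← pow_add, ← pow_add] at h
  have hee : e = (N - d) + N * ks.length := by
    rw [List.length_cons, Nat.mul_succ] at he
    omega
  have hM : (k :: ks).length + (d + js.length) = d + 1 + ks.length + js.length := by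
    rw [List.length_cons]
    omega
  rw [hM, hee, List.map_cons, List.prod_cons, pow_add (mulX m i)]
  convert h using 1
  simp only [mul_assoc]
  rw [← mul_assoc (mulX m i ^ (N * ks.length)), ← hc, mul_assoc]

/-- The Euclidean norm on `ℝⁿ`. -/
noncomputable def euclNorm {n : ℕ} (x : Fin n → ℝ) : ℝ := Real.sqrt (∑ i, x i ^ 2)

lemma sum_sq_pos {n : ℕ} {x : Fin n → ℝ} (hx : x ≠ 0) : 0 < ∑ i, x i ^ 2 := by
  obtain ⟨i, hi⟩ := Function.ne_iff.1 hx
  exact Finset.sum_pos' (fun _ _ => sq_nonneg _) ⟨i, Finset.mem_univ i, by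
    have : x i ≠ 0 := hi
    positivity⟩

lemma euclNorm_pos {n : ℕ} {x : Fin n → ℝ} (hx : x ≠ 0) : 0 < euclNorm x :=
  Real.sqrt_pos.2 (sum_sq_pos hx)

lemma abs_apply_le_euclNorm {n : ℕ} (x : Fin n → ℝ) (i : Fin n) : |x i| ≤ euclNorm x := by
  apply Real.abs_le_sqrt
  exact Finset.single_le_sum (f := fun i => x i ^ 2) (fun _ _ => sq_nonneg _)
    (Finset.mem_univ i)

lemma euclNorm_pow_le {n : ℕ} {x : Fin n → ℝ} (hx : x ≠ 0) (e : ℕ) :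
    euclNorm x ^ e ≤ Real.sqrt n ^ e * ∑ i, |x i| ^ e := by
  obtain ⟨i₀, -⟩ := Function.ne_iff.1 hx
  have : Nonempty (Fin n) := ⟨i₀⟩
  obtain ⟨i, hi⟩ := Finite.exists_max fun i => |x i|
  have h1 : euclNorm x ≤ Real.sqrt n * |x i| := by
    rw [← Real.sqrt_sq_eq_abs, ← Real.sqrt_mul (Nat.cast_nonneg n)]
    apply Real.sqrt_le_sqrt
    calc ∑ j, x j ^ 2 ≤ ∑ _j : Fin n, x i ^ 2 :=
          Finset.sum_le_sum fun j _ => sq_le_sq.2 (hi j)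
      _ = n * x i ^ 2 := by simp
  calc euclNorm x ^ e ≤ (Real.sqrt n * |x i|) ^ e :=
        pow_le_pow_left₀ (euclNorm_pos hx).le h1 e
    _ = Real.sqrt n ^ e * |x i| ^ e := mul_pow _ _ _
    _ ≤ _ := by
      gcongr
      exact Finset.single_le_sum (f := fun i => |x i| ^ e) (fun _ _ => by positivity)
        (Finset.mem_univ i)

/-- A class of functions, smooth and homogeneous of degree `k` away from the origin, closed
under products and, up to lowering the degree, under differentiation. -/
inductive HomCoeff (n : ℕ) : ℤ → ((Fin n → ℝ) → ℝ) → Prop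
  | const (c : ℝ) : HomCoeff n 0 fun _ => c
  | coord (i : Fin n) : HomCoeff n 1 fun x => x i
  | norm (k : ℤ) : HomCoeff n k fun x => euclNorm x ^ k
  | add {k : ℤ} {a b : (Fin n → ℝ) → ℝ} :
      HomCoeff n k a → HomCoeff n k b → HomCoeff n k fun x => a x + b x
  | mul {k l r : ℤ} {a b : (Fin n → ℝ) → ℝ} :
      HomCoeff n k a → HomCoeff n l b → k + l = r → HomCoeff n r fun x => a x * b x

lemma HomCoeff.bound {n : ℕ} {k : ℤ} {a : (Fin n → ℝ) → ℝ} (ha : HomCoeff n k a) :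
    ∃ C : ℝ, 0 ≤ C ∧ ∀ x, x ≠ 0 → |a x| ≤ C * euclNorm x ^ k := by
  induction ha with
  | const c => exact ⟨|c|, abs_nonneg c, fun x _ => by simp⟩
  | coord i => exact ⟨1, zero_le_one, fun x _ => by simpa using abs_apply_le_euclNorm x i⟩
  | norm k =>
    refine ⟨1, zero_le_one, fun x hx => ?_⟩
    rw [abs_of_pos (zpow_pos (euclNorm_pos hx) k), one_mul]
  | add _ _ h h' =>
    obtain ⟨C, hC, h⟩ := h
    obtain ⟨C', hC', h'⟩ := h'
    refine ⟨C + C', by positivity, fun x hx => ?_⟩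
    rw [add_mul]
    exact (abs_add_le _ _).trans (add_le_add (h x hx) (h' x hx))
  | @mul k l r a b _ _ hr h h' =>
    obtain ⟨C, hC, h⟩ := h
    obtain ⟨C', hC', h'⟩ := h'
    refine ⟨C * C', by positivity, fun x hx => ?_⟩
    have hp := euclNorm_pos hx
    calc |a x * b x| = |a x| * |b x| := abs_mul _ _
      _ ≤ (C * euclNorm x ^ k) * (C' * euclNorm x ^ l) :=
        mul_le_mul (h x hx) (h' x hx) (abs_nonneg _) (by positivity)
      _ = C * C' * euclNorm x ^ r := by
        rw [← hr, zpow_add₀ hp.ne']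
        ring

lemma hasFDerivAt_euclNorm {n : ℕ} {x : Fin n → ℝ} (hx : x ≠ 0) :
    HasFDerivAt euclNorm ((euclNorm x)⁻¹ • ∑ i, x i • ContinuousLinearMap.proj (R := ℝ)
      (φ := fun _ : Fin n => ℝ) i) x := by
  have h1 : HasFDerivAt (fun x : Fin n → ℝ => ∑ i, x i ^ 2)
      (∑ i, (2 * x i) • ContinuousLinearMap.proj (R := ℝ) (φ := fun _ : Fin n => ℝ) i) x := by
    refine HasFDerivAt.fun_sum fun i _ => ?_
    simpa using (hasFDerivAt_apply (𝕜 := ℝ) i x).pow 2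
  refine (h1.sqrt (sum_sq_pos hx).ne').congr_fderiv ?_
  refine ContinuousLinearMap.ext fun v => ?_
  have := (euclNorm_pos hx).ne'
  simp only [euclNorm, smul_apply, sum_apply, smul_eq_mul,
    Finset.mul_sum]
  refine Finset.sum_congr rfl fun i _ => ?_
  field_simp

lemma HomCoeff.differentiableAt {n : ℕ} {k : ℤ} {a : (Fin n → ℝ) → ℝ} (ha : HomCoeff n k a)
    {x : Fin n → ℝ} (hx : x ≠ 0) : DifferentiableAt ℝ a x := by
  induction ha with
  | const c => exact differentiableAt_const c
  | coord i => exact differentiableAt_apply i x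
  | norm k =>
    exact (hasFDerivAt_euclNorm hx).differentiableAt.zpow (Or.inl (euclNorm_pos hx).ne')
  | add _ _ h h' => exact h.add h'
  | mul _ _ _ h h' => exact h.mul h'

lemma HomCoeff.exists_partialDeriv {n : ℕ} {k : ℤ} {a : (Fin n → ℝ) → ℝ} (ha : HomCoeff n k a) (j : Fin n) :
    ∃ a', HomCoeff n (k - 1) a' ∧ ∀ x, x ≠ 0 → fderiv ℝ a x (Pi.single j 1) = a' x := by
  induction ha with
  | const c =>
    exact ⟨fun x => 0 * euclNorm x ^ (-1 : ℤ), .mul (.const 0) (.norm (-1)) (by simp),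
      fun x _ => by simp⟩
  | coord i =>
    refine ⟨fun _ => (Pi.single j 1 : Fin n → ℝ) i, .const _, fun x _ => ?_⟩
    rw [(hasFDerivAt_apply (𝕜 := ℝ) i x).fderiv]
    rfl
  | norm k =>
    refine ⟨fun x => k * euclNorm x ^ (k - 1) * (euclNorm x ^ (-1 : ℤ) * x j),
      .mul (.mul (.const k) (.norm (k - 1)) (zero_add _))
        (.mul (.norm (-1)) (.coord j) (by simp : _ = (0 : ℤ))) (by simp), fun x hx => ?_⟩
    have h := (hasDerivAt_zpow k (euclNorm x) (Or.inl (euclNorm_pos hx).ne')).comp_hasFDerivAt x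
      (hasFDerivAt_euclNorm hx)
    change fderiv ℝ ((fun t : ℝ => t ^ k) ∘ euclNorm) x _ = _
    rw [h.fderiv]
    simp [Pi.single_apply]
  | add ha hb h h' =>
    obtain ⟨a', ha', h⟩ := h
    obtain ⟨b', hb', h'⟩ := h'
    refine ⟨_, .add ha' hb', fun x hx => ?_⟩
    rw [fderiv_fun_add (ha.differentiableAt hx) (hb.differentiableAt hx), ← h x hx, ← h' x hx]
    rfl
  | @mul k l r a b ha hb hr h h' =>
    obtain ⟨a', ha', h⟩ := h
    obtain ⟨b', hb', h'⟩ := h'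
    refine ⟨fun x => a x * b' x + a' x * b x,
      .add (.mul ha hb' (by omega)) (.mul ha' hb (by omega)), fun x hx => ?_⟩
    rw [fderiv_fun_mul (ha.differentiableAt hx) (hb.differentiableAt hx)]
    simp [h x hx, h' x hx, mul_comm]

/-- Maps which, off `x = 0`, are finite sums of operators `a(x) ∂_y^κ ∂_x^μ` with `|κ| = s`,
`|μ| = R - d` and `a` homogeneous of degree `N s - d`. -/
inductive GrusinOp (n m N : ℕ) : ℕ → ℕ → (smoothFns n m → Pt n m → ℝ) → Prop
  | single {R : ℕ} {P : smoothFns n m → Pt n m → ℝ} (d : ℕ) (a : (Fin n → ℝ) → ℝ)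
      (ks : List (Fin m)) (js : List (Fin n))
      (ha : HomCoeff n (N * ks.length - d) a) (hR : d + js.length = R)
      (h : ∀ f z, z.1 ≠ 0 →
        P f z = a z.1 * (((ks.map (dyEnd n)).prod * (js.map (dxEnd m)).prod) f).1 z) :
      GrusinOp n m N ks.length R P
  | add {s R : ℕ} {P Q S : smoothFns n m → Pt n m → ℝ} (hP : GrusinOp n m N s R P)
      (hQ : GrusinOp n m N s R Q) (h : ∀ f z, z.1 ≠ 0 → S f z = P f z + Q f z) :
      GrusinOp n m N s R S

lemma eventually_fst_ne_zero {n m : ℕ} {z : Pt n m} (hz : z.1 ≠ 0) :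
    ∀ᶠ w in nhds z, w.1 ≠ 0 :=
  continuous_fst.continuousAt.eventually_ne hz

lemma HomCoeff.hasFDerivAt_comp_fst {n m : ℕ} {k : ℤ} {a : (Fin n → ℝ) → ℝ}
    (ha : HomCoeff n k a) {z : Pt n m} (hz : z.1 ≠ 0) :
    HasFDerivAt (fun w : Pt n m => a w.1)
      ((fderiv ℝ a z.1).comp (ContinuousLinearMap.fst ℝ _ _)) z :=
  (ha.differentiableAt hz).hasFDerivAt.comp z hasFDerivAt_fst

lemma HomCoeff.fderiv_comp_fst_mul_apply {n m : ℕ} {k : ℤ} {a : (Fin n → ℝ) → ℝ}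
    (ha : HomCoeff n k a) {z : Pt n m} (hz : z.1 ≠ 0) (g : smoothFns n m) (v : Pt n m) :
    fderiv ℝ (fun w : Pt n m => a w.1 * g.1 w) z v =
      fderiv ℝ a z.1 v.1 * g.1 z + a z.1 * (dirDeriv v g).1 z := by
  have h := ((ha.hasFDerivAt_comp_fst hz).fun_mul (smoothFns_differentiableAt g z).hasFDerivAt).fderiv
  rw [h]
  change a z.1 * fderiv ℝ g.1 z v + g.1 z * fderiv ℝ a z.1 v.1 =
    _ + a z.1 * fderiv ℝ g.1 z v
  ring

namespace GrusinOp

variable {n m N s R : ℕ} {P : smoothFns n m → Pt n m → ℝ}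

lemma differentiableAt (hP : GrusinOp n m N s R P) (f : smoothFns n m) {z : Pt n m}
    (hz : z.1 ≠ 0) : DifferentiableAt ℝ (P f) z := by
  induction hP with
  | single d a ks js ha hR h =>
    refine DifferentiableAt.congr_of_eventuallyEq ?_
      ((eventually_fst_ne_zero hz).mono fun w hw => h f w hw)
    exact (ha.hasFDerivAt_comp_fst hz).differentiableAt.mul (smoothFns_differentiableAt _ z)
  | add _ _ h hP hQ =>
    exact (hP.add hQ).congr_of_eventuallyEq
      ((eventually_fst_ne_zero hz).mono fun w hw => h f w hw)

lemma fderiv_add_apply {Q S : smoothFns n m → Pt n m → ℝ} (hP : GrusinOp n m N s R P)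
    (hQ : GrusinOp n m N s R Q) (h : ∀ f z, z.1 ≠ 0 → S f z = P f z + Q f z)
    (f : smoothFns n m) {z : Pt n m} (hz : z.1 ≠ 0) (v : Pt n m) :
    fderiv ℝ (S f) z v = fderiv ℝ (P f) z v + fderiv ℝ (Q f) z v := by
  rw [Filter.EventuallyEq.fderiv_eq ((eventually_fst_ne_zero hz).mono fun w hw => h f w hw),
    fderiv_fun_add (hP.differentiableAt f hz) (hQ.differentiableAt f hz)]
  rfl

lemma Dx_comp (hP : GrusinOp n m N s R P) (j : Fin n) :
    GrusinOp n m N s (R + 1) fun f => Dx n m j (P f) := by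
  induction hP with
  | @single R P d a ks js ha hR h =>
    obtain ⟨a', ha', haa'⟩ := ha.exists_partialDeriv j
    have hc : dxEnd m j * (ks.map (dyEnd n)).prod = (ks.map (dyEnd n)).prod * dxEnd m j := by
      apply Commute.list_prod_right
      simp only [List.mem_map]
      rintro _ ⟨k, -, rfl⟩
      exact dirDeriv_commute _ _
    have h1 := GrusinOp.single (N := N) (R := R + 1) (d + 1) a' ks js
      (by push_cast; rwa [← sub_sub]) (by omega) fun f z _ => rfl
    have h2 := GrusinOp.single (N := N) (R := R + 1) d a ks (j :: js) ha
      (by simp; omega) fun f z _ => rfl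
    refine h1.add h2 fun f z hz => ?_
    rw [Dx, Filter.EventuallyEq.fderiv_eq
      ((eventually_fst_ne_zero hz).mono fun w hw => h f w hw), ha.fderiv_comp_fst_mul_apply hz,
      haa' _ hz, List.map_cons, List.prod_cons, ← mul_assoc, ← hc, mul_assoc,
      Module.End.mul_apply (dxEnd m j)]
  | add hP hQ h hP' hQ' => exact hP'.add hQ' fun f z hz => hP.fderiv_add_apply hQ h f hz _

lemma Yop_inr_comp (hP : GrusinOp n m N s R P) (l : Fin m) :
    GrusinOp n m N (s + 1) R fun f => Yop n m N (Sum.inr l) (P f) := by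
  induction hP with
  | @single R P d a ks js ha hR h =>
    refine GrusinOp.single d (fun x => euclNorm x ^ (N : ℤ) * a x) (l :: ks) js
      (.mul (.norm N) ha (by simp only [List.length_cons]; push_cast; ring)) hR fun f z hz => ?_
    change euclNorm z.1 ^ N * fderiv ℝ (P f) z _ = _
    rw [Filter.EventuallyEq.fderiv_eq
      ((eventually_fst_ne_zero hz).mono fun w hw => h f w hw), ha.fderiv_comp_fst_mul_apply hz,
      List.map_cons, List.prod_cons, mul_assoc (dyEnd n l), Module.End.mul_apply (dyEnd n l)]
    simp [mul_assoc]
  | add hP hQ h hP' hQ' =>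
    refine hP'.add hQ' fun f z hz => ?_
    change euclNorm z.1 ^ N * fderiv ℝ _ z _ =
      euclNorm z.1 ^ N * fderiv ℝ _ z _ + euclNorm z.1 ^ N * fderiv ℝ _ z _
    rw [hP.fderiv_add_apply hQ h f hz, mul_add]

lemma exists_bound (hP : GrusinOp n m N s R P) (hs : 1 ≤ s) (hR : R ≤ N) {L : ℕ}
    {E : Module.End ℝ (smoothFns n m)} (hE : E ∈ genSpan n m N ^ L) :
    ∃ C : ℝ, 0 ≤ C ∧ ∀ (f : smoothFns n m) (z : Pt n m), z.1 ≠ 0 → |P (E f) z| ≤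
      C * ∑ β : Fin (s + R + L) → Fin n ⊕ (Fin n × Fin m),
        |Xw (fun i => genIdx n m N (β i)) f.1 z| := by
  induction hP with
  | @single R P d a ks js ha hdR h =>
    obtain ⟨e, he⟩ : ∃ e, e + d = N * ks.length :=
      ⟨N * ks.length - d, Nat.sub_add_cancel
        ((by omega : d ≤ N).trans (Nat.le_mul_of_pos_right N hs))⟩
    have he' : (N * ks.length - d : ℤ) = e := by
      rw [← Nat.cast_mul, ← he]
      simp
    rw [he'] at ha
    obtain ⟨A, hA, ha⟩ := ha.bound
    have hmem (i : Fin n) := mulX_pow_mul_derivs_mem (m := m) (N := N) i js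
      (List.length_pos_iff.1 hs) (by omega) he
    rw [hdR] at hmem
    choose C hC hbound using fun i =>
      exists_bound_of_mem_genSpan_pow ((pow_add (genSpan n m N) _ L).symm ▸
        Submodule.mul_mem_mul (hmem i) hE)
    refine ⟨A * (Real.sqrt n ^ e * ∑ i, C i), mul_nonneg hA (mul_nonneg (by positivity)
      (Finset.sum_nonneg fun i _ => hC i)), fun f z hz => ?_⟩
    rw [h (E f) z hz, abs_mul]
    set g := ((ks.map (dyEnd n)).prod * (js.map (dxEnd m)).prod) (E f)
    set T := ∑ β : Fin (ks.length + R + L) → Fin n ⊕ (Fin n × Fin m),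
        |Xw (fun i => genIdx n m N (β i)) f.1 z|
    have hi (i : Fin n) : |z.1 i| ^ e * |g.1 z| ≤ C i * T := by
      have := hbound i f z
      rwa [Module.End.mul_apply, Module.End.mul_apply, mulX_pow_apply, abs_mul, abs_pow] at this
    calc |a z.1| * |g.1 z|
        ≤ A * (Real.sqrt n ^ e * ∑ i, |z.1 i| ^ e) * |g.1 z| := by
          gcongr
          refine (ha _ hz).trans ?_
          rw [zpow_natCast]
          exact mul_le_mul_of_nonneg_left (euclNorm_pow_le hz e) hA
      _ = A * (Real.sqrt n ^ e * ∑ i, |z.1 i| ^ e * |g.1 z|) := by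
          rw [mul_assoc, mul_assoc, Finset.sum_mul]
      _ ≤ A * (Real.sqrt n ^ e * ∑ i, C i * T) := by
          refine mul_le_mul_of_nonneg_left (mul_le_mul_of_nonneg_left ?_ (by positivity)) hA
          exact Finset.sum_le_sum fun i _ => hi i
      _ = A * (Real.sqrt n ^ e * ∑ i, C i) * T := by
          rw [← Finset.sum_mul]
          ring
  | add _ _ h hP hQ =>
    obtain ⟨C, hC, hP⟩ := hP hs hR
    obtain ⟨C', hC', hQ⟩ := hQ hs hR
    refine ⟨C + C', by positivity, fun f z hz => ?_⟩
    rw [h (E f) z hz, add_mul]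
    exact (abs_add_le _ _).trans (add_le_add (hP f z hz) (hQ f z hz))

end GrusinOp

lemma grusinOp_compOps {n m N : ℕ} (w : List (Fin n ⊕ Fin m)) :
    GrusinOp n m N (w.countP Sum.isRight) (w.countP Sum.isLeft)
      fun f => compOps (w.map (Yop n m N)) f.1 := by
  induction w with
  | nil =>
    exact GrusinOp.single (ks := []) (js := []) 0 (fun _ => 1) (by simpa using HomCoeff.const 1)
      rfl fun f z _ => by simp [compOps]
  | cons i w ih =>
    rcases i with j | l
    · simpa [List.countP_cons, compOps, Yop] using ih.Dx_comp j
    · simpa [List.countP_cons, compOps] using ih.Yop_inr_comp l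

lemma countP_isRight_add_countP_isLeft {α β : Type*} (w : List (α ⊕ β)) :
    w.countP Sum.isRight + w.countP Sum.isLeft = w.length := by
  induction w with
  | nil => rfl
  | cons i w ih => rcases i with j | l <;> simp [List.countP_cons] <;> omega

lemma compOps_append {n m : ℕ} (l l' : List ((Pt n m → ℝ) → Pt n m → ℝ)) (f : Pt n m → ℝ) :
    compOps (l ++ l') f = compOps l (compOps l' f) := by
  induction l with
  | nil => rfl
  | cons op l ih => exact congrArg op ih

lemma exists_bound_Y_word {n m N : ℕ} (w : List (Fin n ⊕ Fin m)) (last : Fin n ⊕ Fin m)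
    (hw : w.length = N + 1)
    (h : last.isLeft = true ∨ (last.isRight = true ∧ ∃ i ∈ w, i.isRight = true)) :
    ∃ C : ℝ, 0 ≤ C ∧ ∀ (f : smoothFns n m) (z : Pt n m), z.1 ≠ 0 →
      |compOps (w.map (Yop n m N) ++ [Yop n m N last]) f.1 z| ≤
        C * ∑ β : Fin (N + 2) → Fin n ⊕ (Fin n × Fin m),
          |Xw (fun i => genIdx n m N (β i)) f.1 z| := by
  have hlen := countP_isRight_add_countP_isLeft w
  rcases last with j | l
  · by_cases hr : 1 ≤ w.countP Sum.isRight
    · have hE : dxEnd m j ∈ genSpan n m N ^ 1 := by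
        rw [pow_one]
        exact dxEnd_mem_genSpan m N j
      obtain ⟨C, hC, hb⟩ := (grusinOp_compOps (N := N) w).exists_bound hr (by omega) hE
      rw [hlen, hw] at hb
      refine ⟨C, hC, fun f z hz => ?_⟩
      rw [compOps_append]
      exact hb f z hz
    · obtain ⟨js, rfl⟩ : ∃ js : List (Fin n), w = js.map Sum.inl := by
        clear hw hlen h
        induction w with
        | nil => exact ⟨[], rfl⟩
        | cons i w ih =>
          rcases i with i | k
          · obtain ⟨js, rfl⟩ := ih (by simpa [List.countP_cons] using hr)
            exact ⟨i :: js, rfl⟩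
          · simp [List.countP_cons] at hr
      rw [List.length_map] at hw
      have hB := prod_dxEnd_mem (m := m) (N := N) (js ++ [j])
      rw [List.length_append, hw] at hB
      obtain ⟨C, hC, hb⟩ := exists_bound_of_mem_genSpan_pow hB
      refine ⟨C, hC, fun f z _ => ?_⟩
      have he := compOps_map_eq_prod (fun j => Yop n m N (Sum.inl j)) (dxEnd m)
        (fun _ _ => rfl) (js ++ [j]) f
      have hmap : (js.map Sum.inl).map (Yop n m N) ++ [Yop n m N (Sum.inl j)] =
          (js ++ [j]).map fun j => Yop n m N (Sum.inl j) := by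
        simp
      rw [hmap, he]
      exact hb f z
  · obtain ⟨i, hi, hir⟩ := (h.resolve_left (by simp)).2
    have hr : 1 ≤ w.countP Sum.isRight := List.countP_pos_iff.2 ⟨i, hi, hir⟩
    have hE : (1 : Module.End ℝ (smoothFns n m)) ∈ genSpan n m N ^ 0 := Submodule.one_le.1 le_rfl
    have hR : (w ++ [Sum.inr l]).countP Sum.isRight = w.countP Sum.isRight + 1 := by simp
    have hL : (w ++ [Sum.inr l]).countP Sum.isLeft = w.countP Sum.isLeft := by simp
    obtain ⟨C, hC, hb⟩ := (grusinOp_compOps (N := N) (w ++ [Sum.inr l])).exists_bound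
      (by omega) (by omega) hE
    rw [countP_isRight_add_countP_isLeft, List.length_append, hw, List.map_append] at hb
    exact ⟨C, hC, hb⟩

lemma ae_fst_ne_zero {n : ℕ} (m : ℕ) (hn : n ≠ 0) :
    ∀ᵐ z : Pt n m, z.1 ≠ 0 := by
  have : Nonempty (Fin n) := ⟨⟨0, Nat.pos_of_ne_zero hn⟩⟩
  have h : ∀ᵐ x : Fin n → ℝ, x ≠ 0 := by
    rw [ae_iff]
    simp
  exact Measure.quasiMeasurePreserving_fst.ae h

lemma eLpNorm_le_of_ae_abs_le_sum {X ι : Type*} [MeasurableSpace X] {μ : Measure X} [Fintype ι]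
    {p : ℝ≥0∞} (hp : 1 ≤ p) {C : ℝ} (hC : 0 ≤ C) {F : X → ℝ} {g : ι → X → ℝ} {S : ℝ≥0∞}
    (hg : ∀ i, AEStronglyMeasurable (g i) μ) (hS : ∀ i, eLpNorm (g i) p μ ≤ S)
    (h : ∀ᵐ x ∂μ, |F x| ≤ C * ∑ i, |g i x|) :
    eLpNorm F p μ ≤ ENNReal.ofReal (C * Fintype.card ι) * S := by
  calc eLpNorm F p μ
      ≤ ENNReal.ofReal C * eLpNorm (∑ i, fun x => |g i x|) p μ := by
        refine eLpNorm_le_mul_eLpNorm_of_ae_le_mul ?_ p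
        filter_upwards [h] with x hx
        rw [Finset.sum_apply, Real.norm_eq_abs, Real.norm_eq_abs]
        exact hx.trans (mul_le_mul_of_nonneg_left (le_abs_self _) hC)
    _ ≤ ENNReal.ofReal C * ∑ i, eLpNorm (fun x => |g i x|) p μ := by
        gcongr
        exact eLpNorm_sum_le (fun i _ => (hg i).norm) hp
    _ ≤ ENNReal.ofReal C * ∑ _i : ι, S := by
        gcongr with i
        exact (eLpNorm_norm (g i)).trans_le (hS i)
    _ = ENNReal.ofReal (C * Fintype.card ι) * S := by
        rw [Finset.sum_const, Finset.card_univ, nsmul_eq_mul, ← mul_assoc, ENNReal.ofReal_mul hC,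
          ENNReal.ofReal_natCast]

/-- (Corollary 3.1, comparison form.)  For `n ≥ 2`, `m, N ≥ 1`,
`p ∈ (1,∞)`, and a word `α = (γ_1,…,γ_(N+1), l)` of length `N+2` such that either `l ≤ n`,
or `l > n` and some `γ_i > n`, there is `c > 0` with
`‖Y^α φ‖_p ≤ c · max_{|β| = N+2} ‖X^β φ‖_p` for all `φ ∈ C_c^∞(ℝ^(n+m))`. -/
theorem Y_riesz_order_N_plus_two_special_words
    (n m N : ℕ) (hn : 2 ≤ n) (hm : 1 ≤ m) (hN : 1 ≤ N) (p : ℝ) (hp : 1 < p)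
    (γ : Fin (N + 1) → (Fin n ⊕ Fin m)) (last : Fin n ⊕ Fin m)
    (hα : last.isLeft = true ∨ (last.isRight = true ∧ ∃ i, (γ i).isRight = true)) :
    ∃ c > (0 : ℝ), ∀ φ : Pt n m → ℝ, ContDiff ℝ (⊤ : ℕ∞) φ → HasCompactSupport φ →
      eLpNorm
          (compOps ((List.ofFn fun i => Yop n m N (γ i)) ++ [Yop n m N last]) φ)
          (ENNReal.ofReal p) volume ≤
        ENNReal.ofReal c *
          ⨆ β : Fin (N + 2) → XIdx n m N, eLpNorm (Xw β φ) (ENNReal.ofReal p) volume := by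
  obtain ⟨C, hC, hb⟩ := exists_bound_Y_word (N := N) (List.ofFn γ) last (by simp)
    (hα.imp id fun ⟨h, i, hi⟩ => ⟨h, γ i, List.mem_ofFn.2 ⟨i, rfl⟩, hi⟩)
  refine ⟨C * Fintype.card (Fin (N + 2) → Fin n ⊕ (Fin n × Fin m)) + 1, by positivity,
    fun φ hφ _ => ?_⟩
  have hw : (List.ofFn γ).map (Yop n m N) = List.ofFn fun i => Yop n m N (γ i) := by
    rw [List.map_ofFn]
    rfl
  rw [← hw]
  have hmeas (β : Fin (N + 2) → Fin n ⊕ (Fin n × Fin m)) :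
      AEStronglyMeasurable (Xw (fun i => genIdx n m N (β i)) φ) := by
    have h := Xw_genIdx (N := N) β ⟨φ, hφ⟩
    rw [h]
    exact (smoothFns_contDiff _).continuous.aestronglyMeasurable
  have hle (β : Fin (N + 2) → Fin n ⊕ (Fin n × Fin m)) :
      eLpNorm (Xw (fun i => genIdx n m N (β i)) φ) (ENNReal.ofReal p) volume ≤
        ⨆ β : Fin (N + 2) → XIdx n m N, eLpNorm (Xw β φ) (ENNReal.ofReal p) volume :=
    le_iSup (fun β : Fin (N + 2) → XIdx n m N => eLpNorm (Xw β φ) (ENNReal.ofReal p) volume)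
      fun i => genIdx n m N (β i)
  have h := eLpNorm_le_of_ae_abs_le_sum (ENNReal.one_le_ofReal.2 hp.le) hC hmeas hle
    ((ae_fst_ne_zero m (by omega)).mono (hb ⟨φ, hφ⟩))
  refine h.trans ?_
  gcongr
  simp
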